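/- For every ordering ξ of the Pascal graph and every path γ ∈ X ∖ X'_ξ, the 3-coding ω_3(γ) ∈ 𝒫_3^ℤ admits exactly one ξ-consistent factoring scheme, namely the natural one determined by the sequence of vertices through which γ passes. -/

import Mathlib

/-- Vertex reached after `n` moves: (number of `false` moves, number of `true` moves). -/
def vertexAt (γ : ℕ → Bool) (n : ℕ) : ℕ × ℕ :=
  (((Finset.range n).filter fun i => γ i = false).card,
   ((Finset.range n).filter fun i => γ i = true).card)

def childOf (v : ℕ × ℕ) (m : Bool) : ℕ × ℕ :=
  if m then (v.1, v.2 + 1) else (v.1 + 1, v.2)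

def MoveMin (ξ : ℕ × ℕ → Bool) (v : ℕ × ℕ) (m : Bool) : Prop :=
  (childOf v m).1 = 0 ∨ (childOf v m).2 = 0 ∨ m = !ξ (childOf v m)

def MoveMax (ξ : ℕ × ℕ → Bool) (v : ℕ × ℕ) (m : Bool) : Prop :=
  (childOf v m).1 = 0 ∨ (childOf v m).2 = 0 ∨ m = ξ (childOf v m)

def IsMinEdge (ξ : ℕ × ℕ → Bool) (γ : ℕ → Bool) (i : ℕ) : Prop :=
  MoveMin ξ (vertexAt γ i) (γ i)

def IsMaxEdge (ξ : ℕ × ℕ → Bool) (γ : ℕ → Bool) (i : ℕ) : Prop :=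
  MoveMax ξ (vertexAt γ i) (γ i)

def XMin (ξ : ℕ × ℕ → Bool) : Set (ℕ → Bool) := {γ | ∀ i, IsMinEdge ξ γ i}

def XMax (ξ : ℕ × ℕ → Bool) : Set (ℕ → Bool) := {γ | ∀ i, IsMaxEdge ξ γ i}

def XPrime (ξ : ℕ × ℕ → Bool) : Set (ℕ → Bool) :=
  {γ | ∃ δ ∈ XMin ξ ∪ XMax ξ, ∃ N : ℕ, ∀ n, N ≤ n → γ n = δ n}

/-- The all-ξ-minimal finite path (list of moves) from the root to a vertex. -/
def minPath (ξ : ℕ × ℕ → Bool) : ℕ × ℕ → List Bool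
  | (0, 0) => []
  | (x + 1, 0) => minPath ξ (x, 0) ++ [false]
  | (0, y + 1) => minPath ξ (0, y) ++ [true]
  | (x + 1, y + 1) =>
      if ξ (x + 1, y + 1) then minPath ξ (x, y + 1) ++ [false]
      else minPath ξ (x + 1, y) ++ [true]
  termination_by p => p.1 + p.2

/-- The all-ξ-maximal finite path (list of moves) from the root to a vertex. -/
def maxPath (ξ : ℕ × ℕ → Bool) : ℕ × ℕ → List Bool
  | (0, 0) => []
  | (x + 1, 0) => maxPath ξ (x, 0) ++ [false]
  | (0, y + 1) => maxPath ξ (0, y) ++ [true]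
  | (x + 1, y + 1) =>
      if ξ (x + 1, y + 1) then maxPath ξ (x + 1, y) ++ [true]
      else maxPath ξ (x, y + 1) ++ [false]
  termination_by p => p.1 + p.2

open Classical in
/-- The adic (Vershik) transformation determined by ξ (identity where undefined). -/
noncomputable def adicT (ξ : ℕ × ℕ → Bool) (γ : ℕ → Bool) : ℕ → Bool :=
  if h : ∃ i, ¬ IsMaxEdge ξ γ i then
    let i0 := Nat.find h
    let v := vertexAt γ (i0 + 1)
    let src : ℕ × ℕ := if ξ v then (v.1, v.2 - 1) else (v.1 - 1, v.2)
    fun n =>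
      if n < i0 then (minPath ξ src).getD n false
      else if n = i0 then ξ v
      else γ n
  else γ

open Classical in
/-- The inverse adic transformation determined by ξ (identity where undefined). -/
noncomputable def adicTInv (ξ : ℕ × ℕ → Bool) (γ : ℕ → Bool) : ℕ → Bool :=
  if h : ∃ i, ¬ IsMinEdge ξ γ i then
    let i0 := Nat.find h
    let v := vertexAt γ (i0 + 1)
    let src : ℕ × ℕ := if ξ v then (v.1 - 1, v.2) else (v.1, v.2 - 1)
    fun n =>
      if n < i0 then (maxPath ξ src).getD n false
      else if n = i0 then !ξ v
      else γ n
  else γ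

/-- ℤ-iterates of the adic transformation. -/
noncomputable def adicIter (ξ : ℕ × ℕ → Bool) : ℤ → (ℕ → Bool) → (ℕ → Bool)
  | Int.ofNat n, γ => (adicT ξ)^[n] γ
  | Int.negSucc n, γ => (adicTInv ξ)^[n + 1] γ

/-- The k-coding of the orbit of γ: symbols are the initial segments of length k. -/
noncomputable def omegaCode (ξ : ℕ × ℕ → Bool) (k : ℕ) (γ : ℕ → Bool) : ℤ → List Bool :=
  fun t => (List.range k).map (adicIter ξ t γ)

/-- Ordered list of all initial segments from the root to (x,y), in increasing ξ-order. -/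
def segList (ξ : ℕ × ℕ → Bool) : ℕ × ℕ → List (List Bool)
  | (0, 0) => [[]]
  | (x + 1, 0) => (segList ξ (x, 0)).map (· ++ [false])
  | (0, y + 1) => (segList ξ (0, y)).map (· ++ [true])
  | (x + 1, y + 1) =>
      if ξ (x + 1, y + 1) then
        (segList ξ (x, y + 1)).map (· ++ [false]) ++ (segList ξ (x + 1, y)).map (· ++ [true])
      else
        (segList ξ (x + 1, y)).map (· ++ [true]) ++ (segList ξ (x, y + 1)).map (· ++ [false])
  termination_by p => p.1 + p.2

/-- Level-k coded basic block at a vertex (x,y) with x+y ≥ k, a word over the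
alphabet of initial segments of length k. -/
def codedBlock (ξ : ℕ × ℕ → Bool) (k : ℕ) : ℕ × ℕ → List (List Bool)
  | (0, 0) => segList ξ (0, 0)
  | (x + 1, 0) => if x + 1 ≤ k then segList ξ (x + 1, 0) else [List.replicate k false]
  | (0, y + 1) => if y + 1 ≤ k then segList ξ (0, y + 1) else [List.replicate k true]
  | (x + 1, y + 1) =>
      if x + 1 + (y + 1) ≤ k then segList ξ (x + 1, y + 1)
      else if ξ (x + 1, y + 1) then codedBlock ξ k (x, y + 1) ++ codedBlock ξ k (x + 1, y)
      else codedBlock ξ k (x + 1, y) ++ codedBlock ξ k (x, y + 1)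
  termination_by p => p.1 + p.2

/-- Basic block over the alphabet {a,b}, with a = `false` and b = `true`. -/
def basicBlock (ξ : ℕ × ℕ → Bool) : ℕ × ℕ → List Bool
  | (0, 0) => []
  | (_ + 1, 0) => [false]
  | (0, _ + 1) => [true]
  | (x + 1, y + 1) =>
      if ξ (x + 1, y + 1) then basicBlock ξ (x, y + 1) ++ basicBlock ξ (x + 1, y)
      else basicBlock ξ (x + 1, y) ++ basicBlock ξ (x, y + 1)
  termination_by p => p.1 + p.2

/-- The finite word ω_s ω_{s+1} ... ω_{t-1}. -/
def wordAt (ω : ℤ → List Bool) (s t : ℤ) : List (List Bool) :=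
  (List.range (t - s).toNat).map fun u => ω (s + u)

/-- A ξ-consistent factoring scheme for ω ∈ 𝒫_k^ℤ: `cuts j` is the set of starting
positions of the blocks of the level-(k+j) factorization, and `vert j s` is the
vertex whose coded basic block is the block starting at the cut `s`. -/
def IsConsistentScheme (ξ : ℕ × ℕ → Bool) (k : ℕ) (ω : ℤ → List Bool)
    (cuts : ℕ → Set ℤ) (vert : ℕ → ℤ → ℕ × ℕ) : Prop :=
  (∀ j : ℕ, ∀ M : ℤ, ∃ s ∈ cuts j, s < M) ∧
  (∀ j : ℕ, ∀ M : ℤ, ∃ t ∈ cuts j, M < t) ∧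
  (∀ j : ℕ, ∀ s ∈ cuts j, ∀ t ∈ cuts j, s < t → (∀ u ∈ cuts j, ¬(s < u ∧ u < t)) →
      (vert j s).1 + (vert j s).2 = k + j ∧
      wordAt ω s t = codedBlock ξ k (vert j s)) ∧
  (∀ j : ℕ, cuts (j + 1) ⊆ cuts j) ∧
  (∀ j : ℕ, ∀ s ∈ cuts (j + 1), ∀ t ∈ cuts (j + 1), s < t →
      (∀ u ∈ cuts (j + 1), ¬(s < u ∧ u < t)) →
      ∀ x y : ℕ, vert (j + 1) s = (x + 1, y + 1) →
        ∃ m ∈ cuts j, s < m ∧ m < t ∧ (∀ u ∈ cuts j, s < u → u < t → u = m) ∧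
          (if ξ (x + 1, y + 1)
            then vert j s = (x, y + 1) ∧ vert j m = (x + 1, y)
            else vert j s = (x + 1, y) ∧ vert j m = (x, y + 1)))

/-- The natural factoring scheme of the k-coding of γ: a level-(k+j) block begins at
coordinate t exactly when T^t γ begins with an all-ξ-minimal path to its level-(k+j) vertex. -/
noncomputable def natCuts (ξ : ℕ × ℕ → Bool) (k : ℕ) (γ : ℕ → Bool) : ℕ → Set ℤ :=
  fun j => {t | ∀ i < k + j, IsMinEdge ξ (adicIter ξ t γ) i}

noncomputable def natVert (ξ : ℕ × ℕ → Bool) (k : ℕ) (γ : ℕ → Bool) : ℕ → ℤ → ℕ × ℕ :=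
  fun j t => vertexAt (adicIter ξ t γ) (k + j)

open Classical in
/-- The return time r_n of the Kink Lemma, where `g` is the move of γ leaving (i,j). -/
noncomputable def kinkReturn (ξ : ℕ × ℕ → Bool) (i j : ℕ) (g : Bool) : ℕ :=
  let n := i + j
  if MoveMax ξ (i, j) g ∧ MoveMin ξ (i, j) (!g) then n.choose j
  else if (MoveMin ξ (i, j) g ∧ MoveMin ξ (i, j) (!g) ∧ g = true) ∨
          (MoveMax ξ (i, j) g ∧ MoveMax ξ (i, j) (!g) ∧ g = false) then (n + 1).choose (j + 1)
  else if (MoveMin ξ (i, j) g ∧ MoveMin ξ (i, j) (!g) ∧ g = false) ∨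
          (MoveMax ξ (i, j) g ∧ MoveMax ξ (i, j) (!g) ∧ g = true) then (n + 1).choose j
  else (n + 1).choose j + n.choose (j + 1)

/-- Convert a length-k list of moves to a function `Fin k → Bool`. -/
def segFn (k : ℕ) (w : List Bool) : Fin k → Bool := fun idx => w.getD idx false

/-- The subshift Σ_k of the k-codings: sequences all of whose finite subblocks occur
in some level-k coded basic block. -/
def SigmaK (ξ : ℕ × ℕ → Bool) (k : ℕ) : Set (ℤ → (Fin k → Bool)) :=
  {ω | ∀ (s : ℤ) (l : ℕ), ∃ p : ℕ × ℕ,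
    ((List.range l).map fun u => ω (s + u)) <:+: (codedBlock ξ k p).map (segFn k)}

/-- The subshift Σ_ξ ⊆ {a,b}^ℤ of sequences all of whose finite subblocks occur in
some basic block B_ξ(x,y). -/
def SigmaXi (ξ : ℕ × ℕ → Bool) : Set (ℤ → Bool) :=
  {ω | ∀ (s : ℤ) (l : ℕ), ∃ p : ℕ × ℕ,
    ((List.range l).map fun u => ω (s + u)) <:+: basicBlock ξ p}

/-- The big subshift Σ: sequences all of whose finite subblocks occur in some basic
block B_ξ(x,y) for some ordering ξ. -/
def BigShift : Set (ℤ → Bool) :=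
  {ω | ∀ (s : ℤ) (l : ℕ), ∃ (ξ : ℕ × ℕ → Bool) (p : ℕ × ℕ),
    ((List.range l).map fun u => ω (s + u)) <:+: basicBlock ξ p}


/-- The initial segment of length `n` of a path. -/
def seg (δ : ℕ → Bool) (n : ℕ) : List Bool := (List.range n).map δ

/-- The endpoint of a finite path given by its list of moves. -/
def endpoint (w : List Bool) : ℕ × ℕ := (w.count false, w.count true)

lemma seg_succ (δ : ℕ → Bool) (n : ℕ) : seg δ (n + 1) = seg δ n ++ [δ n] := by
  simp [seg, List.range_succ]

@[simp] lemma length_seg (δ : ℕ → Bool) (n : ℕ) : (seg δ n).length = n := by simp [seg]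

lemma endpoint_append (w : List Bool) (m : Bool) :
    endpoint (w ++ [m]) = childOf (endpoint w) m := by
  cases m <;> simp [endpoint, childOf]

lemma vertexAt_succ (δ : ℕ → Bool) (n : ℕ) :
    vertexAt δ (n + 1) = childOf (vertexAt δ n) (δ n) := by
  cases h : δ n <;> simp [vertexAt, childOf, Finset.range_add_one, Finset.filter_insert, h]

lemma vertexAt_eq_endpoint (δ : ℕ → Bool) (n : ℕ) : vertexAt δ n = endpoint (seg δ n) := by
  induction n with
  | zero => rfl
  | succ n ih => rw [vertexAt_succ, seg_succ, endpoint_append, ih]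

lemma childOf_sum (v : ℕ × ℕ) (m : Bool) : (childOf v m).1 + (childOf v m).2 = v.1 + v.2 + 1 := by
  cases m <;> simp [childOf] <;> omega

lemma vertexAt_sum (δ : ℕ → Bool) (n : ℕ) : (vertexAt δ n).1 + (vertexAt δ n).2 = n := by
  induction n with
  | zero => rfl
  | succ n ih => rw [vertexAt_succ, childOf_sum, ih]

lemma eq_of_seg_eq {δ ε : ℕ → Bool} {n : ℕ} (h : seg δ n = seg ε n) {i : ℕ} (hi : i < n) :
    δ i = ε i := by
  simp only [seg, List.map_inj_left, List.mem_range] at h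
  exact h i hi

lemma seg_eq_of_getD {δ : ℕ → Bool} {n : ℕ} {w : List Bool} (hw : w.length = n)
    (h : ∀ i < n, δ i = w.getD i false) : seg δ n = w := by
  apply List.ext_getElem (by simp [hw])
  intro i h1 h2
  simp [seg, h i (hw ▸ h2), h2]

lemma childOf_cases (v : ℕ × ℕ) (m : Bool) :
    (∃ x, v = (x, 0) ∧ m = false ∧ childOf v m = (x + 1, 0)) ∨
    (∃ y, v = (0, y) ∧ m = true ∧ childOf v m = (0, y + 1)) ∨
    (∃ x y, v = (x, y + 1) ∧ m = false ∧ childOf v m = (x + 1, y + 1)) ∨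
    (∃ x y, v = (x + 1, y) ∧ m = true ∧ childOf v m = (x + 1, y + 1)) := by
  obtain ⟨x, y⟩ := v
  cases m <;> simp only [childOf]
  · cases y <;> simp
  · cases x <;> simp

lemma endpoint_minPath (ξ : ℕ × ℕ → Bool) (v : ℕ × ℕ) : endpoint (minPath ξ v) = v := by
  fun_induction minPath ξ v <;> first | rfl | simp_all [endpoint_append, childOf]

lemma endpoint_maxPath (ξ : ℕ × ℕ → Bool) (v : ℕ × ℕ) : endpoint (maxPath ξ v) = v := by
  fun_induction maxPath ξ v <;> first | rfl | simp_all [endpoint_append, childOf]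

lemma length_eq_endpoint (w : List Bool) : w.length = (endpoint w).1 + (endpoint w).2 := by
  simp [endpoint, List.count_false_add_count_true]

lemma append_eq_minPath_iff (ξ : ℕ × ℕ → Bool) (w : List Bool) (v : ℕ × ℕ) (m : Bool) :
    w ++ [m] = minPath ξ (childOf v m) ↔ w = minPath ξ v ∧ MoveMin ξ v m := by
  rcases childOf_cases v m with ⟨x, rfl, rfl, h⟩ | ⟨x, rfl, rfl, h⟩ | ⟨x, y, rfl, rfl, h⟩ |
    ⟨x, y, rfl, rfl, h⟩ <;> rw [MoveMin, h, minPath] <;> simp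
  all_goals cases hx : ξ (x + 1, y + 1) <;> simp

lemma append_eq_maxPath_iff (ξ : ℕ × ℕ → Bool) (w : List Bool) (v : ℕ × ℕ) (m : Bool) :
    w ++ [m] = maxPath ξ (childOf v m) ↔ w = maxPath ξ v ∧ MoveMax ξ v m := by
  rcases childOf_cases v m with ⟨x, rfl, rfl, h⟩ | ⟨x, rfl, rfl, h⟩ | ⟨x, y, rfl, rfl, h⟩ |
    ⟨x, y, rfl, rfl, h⟩ <;> rw [MoveMax, h, maxPath] <;> simp
  all_goals cases hx : ξ (x + 1, y + 1) <;> simp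

lemma seg_eq_minPath_iff (ξ : ℕ × ℕ → Bool) (δ : ℕ → Bool) (n : ℕ) :
    seg δ n = minPath ξ (vertexAt δ n) ↔ ∀ i < n, IsMinEdge ξ δ i := by
  induction n with
  | zero => simp [seg, vertexAt, minPath]
  | succ n ih =>
    rw [seg_succ, vertexAt_succ, append_eq_minPath_iff, ih, Nat.forall_lt_succ_right]
    rfl

lemma seg_eq_maxPath_iff (ξ : ℕ × ℕ → Bool) (δ : ℕ → Bool) (n : ℕ) :
    seg δ n = maxPath ξ (vertexAt δ n) ↔ ∀ i < n, IsMaxEdge ξ δ i := by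
  induction n with
  | zero => simp [seg, vertexAt, maxPath]
  | succ n ih =>
    rw [seg_succ, vertexAt_succ, append_eq_maxPath_iff, ih, Nat.forall_lt_succ_right]
    rfl

lemma forall_isMinEdge_of_seg_eq {ξ : ℕ × ℕ → Bool} {δ : ℕ → Bool} {n : ℕ} {v : ℕ × ℕ}
    (h : seg δ n = minPath ξ v) : vertexAt δ n = v ∧ ∀ i < n, IsMinEdge ξ δ i := by
  have hv : vertexAt δ n = v := by rw [vertexAt_eq_endpoint, h, endpoint_minPath]
  exact ⟨hv, (seg_eq_minPath_iff ξ δ n).1 (hv ▸ h)⟩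

lemma forall_isMaxEdge_of_seg_eq {ξ : ℕ × ℕ → Bool} {δ : ℕ → Bool} {n : ℕ} {v : ℕ × ℕ}
    (h : seg δ n = maxPath ξ v) : vertexAt δ n = v ∧ ∀ i < n, IsMaxEdge ξ δ i := by
  have hv : vertexAt δ n = v := by rw [vertexAt_eq_endpoint, h, endpoint_maxPath]
  exact ⟨hv, (seg_eq_maxPath_iff ξ δ n).1 (hv ▸ h)⟩

lemma head?_segList (ξ : ℕ × ℕ → Bool) (v : ℕ × ℕ) :
    (segList ξ v).head? = some (minPath ξ v) := by
  fun_induction segList ξ v <;> simp_all [minPath]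

lemma getLast?_segList (ξ : ℕ × ℕ → Bool) (v : ℕ × ℕ) :
    (segList ξ v).getLast? = some (maxPath ξ v) := by
  fun_induction segList ξ v <;> simp_all [maxPath]

lemma endpoint_of_mem_segList {ξ : ℕ × ℕ → Bool} {v : ℕ × ℕ} {w : List Bool}
    (h : w ∈ segList ξ v) : endpoint w = v := by
  fun_induction segList ξ v generalizing w <;>
    simp only [List.mem_append, List.mem_map, List.mem_singleton] at h
  · subst h; rfl
  · grind [endpoint_append, childOf]
  · grind [endpoint_append, childOf]
  · grind [endpoint_append, childOf]
  · grind [endpoint_append, childOf]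

lemma nodup_segList (ξ : ℕ × ℕ → Bool) (v : ℕ × ℕ) : (segList ξ v).Nodup := by
  have hinj : ∀ b : Bool, Function.Injective (fun w : List Bool => w ++ [b]) :=
    fun b => List.append_left_injective [b]
  fun_induction segList ξ v
  · simp
  · exact List.Nodup.map (hinj _) ‹_›
  · exact List.Nodup.map (hinj _) ‹_›
  all_goals
    refine List.Nodup.append (List.Nodup.map (hinj _) ‹_›) (List.Nodup.map (hinj _) ‹_›) ?_
    simp [List.disjoint_left]

lemma length_segList_le (ξ : ℕ × ℕ → Bool) (v : ℕ × ℕ) :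
    (segList ξ v).length ≤ 2 ^ (v.1 + v.2) := by
  fun_induction segList ξ v <;> simp_all [pow_succ, ← add_assoc] <;> grind

lemma length_segList_pos (ξ : ℕ × ℕ → Bool) (v : ℕ × ℕ) : 0 < (segList ξ v).length := by
  have := head?_segList ξ v
  rcases h : segList ξ v <;> simp_all

lemma mem_segList_append {ξ : ℕ × ℕ → Bool} {v : ℕ × ℕ} {w : List Bool} (h : w ∈ segList ξ v)
    (m : Bool) : w ++ [m] ∈ segList ξ (childOf v m) := by
  rcases childOf_cases v m with ⟨x, rfl, rfl, h'⟩ | ⟨x, rfl, rfl, h'⟩ | ⟨x, y, rfl, rfl, h'⟩ |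
    ⟨x, y, rfl, rfl, h'⟩ <;> rw [h', segList] <;> try split
  all_goals simp [h]

lemma seg_mem_segList (ξ : ℕ × ℕ → Bool) (δ : ℕ → Bool) (n : ℕ) :
    seg δ n ∈ segList ξ (vertexAt δ n) := by
  induction n with
  | zero => simp [seg, vertexAt, segList]
  | succ n ih => rw [seg_succ, vertexAt_succ]; exact mem_segList_append ih _

lemma segList_zero_right (ξ : ℕ × ℕ → Bool) (x : ℕ) :
    segList ξ (x, 0) = [List.replicate x false] := by
  induction x with
  | zero => simp [segList]
  | succ x ih => simp [segList, ih, List.replicate_succ']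

lemma segList_zero_left (ξ : ℕ × ℕ → Bool) (y : ℕ) :
    segList ξ (0, y) = [List.replicate y true] := by
  induction y with
  | zero => simp [segList]
  | succ y ih => simp [segList, ih, List.replicate_succ']

lemma codedBlock_eq_map_take (ξ : ℕ × ℕ → Bool) (k : ℕ) (v : ℕ × ℕ) (hv : k ≤ v.1 + v.2) :
    codedBlock ξ k v = (segList ξ v).map (List.take k) := by
  have hself : ∀ v : ℕ × ℕ, k ≤ v.1 + v.2 → v.1 + v.2 ≤ k →
      segList ξ v = (segList ξ v).map (List.take k) := by
    intro v h1 h2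
    symm
    conv_rhs => rw [← List.map_id (segList ξ v)]
    rw [List.map_inj_left]
    intro w hw
    apply List.take_of_length_le
    rw [length_eq_endpoint, endpoint_of_mem_segList hw, h2.antisymm h1]
  have happ : ∀ (v : ℕ × ℕ) (b : Bool), k ≤ v.1 + v.2 →
      ((segList ξ v).map (· ++ [b])).map (List.take k) = (segList ξ v).map (List.take k) := by
    intro v b h
    rw [List.map_map, List.map_inj_left]
    intro w hw
    have := length_eq_endpoint w
    rw [endpoint_of_mem_segList hw] at this
    simp [List.take_append, show k - w.length = 0 by omega]
  fun_induction codedBlock ξ k v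
  · exact hself _ hv (by simp)
  · exact hself _ hv (by simpa)
  · rw [segList_zero_right]; simp only [List.map_cons, List.take_replicate, List.map_nil]
    rw [min_eq_left (by simpa using hv)]
  · exact hself _ hv (by simpa)
  · rw [segList_zero_left]; simp only [List.map_cons, List.take_replicate, List.map_nil]
    rw [min_eq_left (by simpa using hv)]
  · exact hself _ hv (by simpa)
  · rename_i ih1 ih2
    rw [segList, if_pos ‹_›, List.map_append, happ, happ, ih1, ih2] <;> simp <;> omega
  · rename_i ih1 ih2
    rw [segList, if_neg ‹_›, List.map_append, happ, happ, ih1, ih2] <;> simp <;> omega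

lemma adicT_spec {ξ : ℕ × ℕ → Bool} {δ : ℕ → Bool} {n : ℕ} (hmax : ∀ i < n, IsMaxEdge ξ δ i)
    (hn : ¬ IsMaxEdge ξ δ n) :
    ∃ x y, vertexAt δ (n + 1) = (x + 1, y + 1) ∧ δ n = !ξ (x + 1, y + 1) ∧
      (∀ k, n < k → adicT ξ δ k = δ k) ∧ adicT ξ δ n = ξ (x + 1, y + 1) ∧
      seg (adicT ξ δ) n = minPath ξ (if ξ (x + 1, y + 1) then (x + 1, y) else (x, y + 1)) := by
  classical
  have hex : ∃ i, ¬ IsMaxEdge ξ δ i := ⟨n, hn⟩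
  have hfind : Nat.find hex = n := by
    rw [Nat.find_eq_iff]
    exact ⟨hn, fun i hi h => h (hmax i hi)⟩
  have hv := vertexAt_succ δ n
  have hsum := vertexAt_sum δ (n + 1)
  obtain ⟨x, y, hxy⟩ : ∃ x y, vertexAt δ (n + 1) = (x + 1, y + 1) := by
    rcases childOf_cases (vertexAt δ n) (δ n) with ⟨x, h1, h2, h3⟩ | ⟨x, h1, h2, h3⟩ |
      ⟨x, y, h1, h2, h3⟩ | ⟨x, y, h1, h2, h3⟩
    · exact absurd (Or.inr (Or.inl (by rw [h3]))) hn
    · exact absurd (Or.inl (by rw [h3])) hn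
    · exact ⟨x, y, hv.trans h3⟩
    · exact ⟨x, y, hv.trans h3⟩
  rw [hxy] at hsum
  refine ⟨x, y, hxy, ?_⟩
  simp only [adicT, dif_pos hex, hfind, hxy]
  refine ⟨?_, fun k hk => by simp [hk.not_gt, hk.ne'], by simp, ?_⟩
  · have : ¬ MoveMax ξ (vertexAt δ n) (δ n) := hn
    rw [MoveMax, ← hv, hxy] at this
    cases h1 : δ n <;> cases h2 : ξ (x + 1, y + 1) <;> simp_all
  · apply seg_eq_of_getD
    · rw [length_eq_endpoint, endpoint_minPath]
      simp only at hsum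
      split <;> simp only <;> omega
    · intro i hi
      rw [if_pos hi]
      split <;> rfl

lemma adicTInv_spec {ξ : ℕ × ℕ → Bool} {δ : ℕ → Bool} {n : ℕ} (hmin : ∀ i < n, IsMinEdge ξ δ i)
    (hn : ¬ IsMinEdge ξ δ n) :
    ∃ x y, vertexAt δ (n + 1) = (x + 1, y + 1) ∧ δ n = ξ (x + 1, y + 1) ∧
      (∀ k, n < k → adicTInv ξ δ k = δ k) ∧ adicTInv ξ δ n = (!ξ (x + 1, y + 1)) ∧
      seg (adicTInv ξ δ) n = maxPath ξ (if ξ (x + 1, y + 1) then (x, y + 1) else (x + 1, y)) := by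
  classical
  have hex : ∃ i, ¬ IsMinEdge ξ δ i := ⟨n, hn⟩
  have hfind : Nat.find hex = n := by
    rw [Nat.find_eq_iff]
    exact ⟨hn, fun i hi h => h (hmin i hi)⟩
  have hv := vertexAt_succ δ n
  have hsum := vertexAt_sum δ (n + 1)
  obtain ⟨x, y, hxy⟩ : ∃ x y, vertexAt δ (n + 1) = (x + 1, y + 1) := by
    rcases childOf_cases (vertexAt δ n) (δ n) with ⟨x, h1, h2, h3⟩ | ⟨x, h1, h2, h3⟩ |
      ⟨x, y, h1, h2, h3⟩ | ⟨x, y, h1, h2, h3⟩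
    · exact absurd (Or.inr (Or.inl (by rw [h3]))) hn
    · exact absurd (Or.inl (by rw [h3])) hn
    · exact ⟨x, y, hv.trans h3⟩
    · exact ⟨x, y, hv.trans h3⟩
  rw [hxy] at hsum
  refine ⟨x, y, hxy, ?_⟩
  simp only [adicTInv, dif_pos hex, hfind, hxy]
  refine ⟨?_, fun k hk => by simp [hk.not_gt, hk.ne'], by simp, ?_⟩
  · have : ¬ MoveMin ξ (vertexAt δ n) (δ n) := hn
    rw [MoveMin, ← hv, hxy] at this
    cases h1 : δ n <;> cases h2 : ξ (x + 1, y + 1) <;> simp_all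
  · apply seg_eq_of_getD
    · rw [length_eq_endpoint, endpoint_maxPath]
      simp only at hsum
      split <;> simp only <;> omega
    · intro i hi
      rw [if_pos hi]
      split <;> rfl

lemma exists_first_not_isMaxEdge {ξ : ℕ × ℕ → Bool} {δ : ℕ → Bool} (h : δ ∉ XMax ξ) :
    ∃ n, (∀ i < n, IsMaxEdge ξ δ i) ∧ ¬ IsMaxEdge ξ δ n := by
  classical
  have hex : ∃ i, ¬ IsMaxEdge ξ δ i := by simpa [XMax] using h
  exact ⟨Nat.find hex, fun i hi => not_not.1 (Nat.find_min hex hi), Nat.find_spec hex⟩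

lemma exists_first_not_isMinEdge {ξ : ℕ × ℕ → Bool} {δ : ℕ → Bool} (h : δ ∉ XMin ξ) :
    ∃ n, (∀ i < n, IsMinEdge ξ δ i) ∧ ¬ IsMinEdge ξ δ n := by
  classical
  have hex : ∃ i, ¬ IsMinEdge ξ δ i := by simpa [XMin] using h
  exact ⟨Nat.find hex, fun i hi => not_not.1 (Nat.find_min hex hi), Nat.find_spec hex⟩

lemma notMem_XMin_of_notMem_XPrime {ξ : ℕ × ℕ → Bool} {δ : ℕ → Bool} (h : δ ∉ XPrime ξ) :
    δ ∉ XMin ξ :=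
  fun h' => h ⟨δ, Or.inl h', 0, fun _ _ => rfl⟩

lemma notMem_XMax_of_notMem_XPrime {ξ : ℕ × ℕ → Bool} {δ : ℕ → Bool} (h : δ ∉ XPrime ξ) :
    δ ∉ XMax ξ :=
  fun h' => h ⟨δ, Or.inr h', 0, fun _ _ => rfl⟩

lemma notMem_XPrime_congr {ξ : ℕ × ℕ → Bool} {δ ε : ℕ → Bool} {N : ℕ} (h : δ ∉ XPrime ξ)
    (hN : ∀ k, N < k → ε k = δ k) : ε ∉ XPrime ξ := by
  rintro ⟨ζ, hζ, M, hM⟩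
  exact h ⟨ζ, hζ, max M (N + 1), fun n hn => by
    rw [← hM n (by omega), hN n (by omega)]⟩

lemma adicT_notMem_XPrime {ξ : ℕ × ℕ → Bool} {δ : ℕ → Bool} (h : δ ∉ XPrime ξ) :
    adicT ξ δ ∉ XPrime ξ := by
  obtain ⟨n, h1, h2⟩ := exists_first_not_isMaxEdge (notMem_XMax_of_notMem_XPrime h)
  obtain ⟨x, y, -, -, h3, -⟩ := adicT_spec h1 h2
  exact notMem_XPrime_congr h h3

lemma adicTInv_notMem_XPrime {ξ : ℕ × ℕ → Bool} {δ : ℕ → Bool} (h : δ ∉ XPrime ξ) :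
    adicTInv ξ δ ∉ XPrime ξ := by
  obtain ⟨n, h1, h2⟩ := exists_first_not_isMinEdge (notMem_XMin_of_notMem_XPrime h)
  obtain ⟨x, y, -, -, h3, -⟩ := adicTInv_spec h1 h2
  exact notMem_XPrime_congr h h3

lemma ext_of_seg_eq {δ ε : ℕ → Bool} {n : ℕ} (h1 : seg δ n = seg ε n) (h2 : δ n = ε n)
    (h3 : ∀ k, n < k → δ k = ε k) : δ = ε := by
  funext k
  rcases lt_trichotomy k n with h | rfl | h
  · exact eq_of_seg_eq h1 h
  · exact h2
  · exact h3 k h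

lemma adicT_adicTInv {ξ : ℕ × ℕ → Bool} {δ : ℕ → Bool} (h : δ ∉ XMin ξ) :
    adicT ξ (adicTInv ξ δ) = δ := by
  obtain ⟨n, h1, h2⟩ := exists_first_not_isMinEdge h
  obtain ⟨x, y, hv, hδ, htail, hn, hseg⟩ := adicTInv_spec h1 h2
  set ε := adicTInv ξ δ
  obtain ⟨hεn, hmax⟩ := forall_isMaxEdge_of_seg_eq hseg
  have hv' : vertexAt ε (n + 1) = (x + 1, y + 1) := by
    rw [vertexAt_succ, hεn, hn]
    cases ξ (x + 1, y + 1) <;> simp [childOf]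
  have hnmax : ¬ IsMaxEdge ξ ε n := by
    rw [IsMaxEdge, MoveMax, ← vertexAt_succ, hv', hn]
    simp
  obtain ⟨x', y', hw, -, htail', hn', hseg'⟩ := adicT_spec hmax hnmax
  obtain ⟨rfl, rfl⟩ : x' = x ∧ y' = y := by
    rw [hv'] at hw; simp at hw; omega
  refine ext_of_seg_eq (n := n) ?_ (hn'.trans hδ.symm) fun k hk => (htail' k hk).trans (htail k hk)
  rw [hseg', (seg_eq_minPath_iff ξ δ n).2 h1]
  congr 1
  rw [vertexAt_succ, hδ] at hv
  cases hx : ξ (x' + 1, y' + 1) <;> rw [hx] at hv <;> simp [childOf, Prod.ext_iff] at hv <;>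
    simp [Prod.ext_iff, hv]

lemma adicIter_notMem_XPrime {ξ : ℕ × ℕ → Bool} {γ : ℕ → Bool} (h : γ ∉ XPrime ξ) (t : ℤ) :
    adicIter ξ t γ ∉ XPrime ξ := by
  cases t with
  | ofNat n =>
    simp only [adicIter]
    induction n with
    | zero => exact h
    | succ n ih => rw [Function.iterate_succ_apply']; exact adicT_notMem_XPrime ih
  | negSucc n =>
    simp only [adicIter]
    induction n with
    | zero => exact adicTInv_notMem_XPrime h
    | succ n ih => rw [Function.iterate_succ_apply']; exact adicTInv_notMem_XPrime ih

lemma adicIter_add_one {ξ : ℕ × ℕ → Bool} {γ : ℕ → Bool} (h : γ ∉ XPrime ξ) (t : ℤ) :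
    adicIter ξ (t + 1) γ = adicT ξ (adicIter ξ t γ) := by
  cases t with
  | ofNat n => exact Function.iterate_succ_apply' (adicT ξ) n γ
  | negSucc n =>
    cases n with
    | zero => exact (adicT_adicTInv (notMem_XMin_of_notMem_XPrime h)).symm
    | succ n =>
      have h' := adicIter_notMem_XPrime h (Int.negSucc n)
      have : Int.negSucc (n + 1) + 1 = Int.negSucc n := by omega
      rw [this]
      have e : adicIter ξ (Int.negSucc (n + 1)) γ = adicTInv ξ (adicIter ξ (Int.negSucc n) γ) :=
        Function.iterate_succ_apply' (adicTInv ξ) (n + 1) γ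
      rw [e, adicT_adicTInv (notMem_XMin_of_notMem_XPrime h')]

lemma getElem?_map_append {P : List (List Bool)} {p b : Bool} {i : ℕ} {w : List Bool} :
    (P.map (· ++ [p]))[i]? = some (w ++ [b]) ↔ b = p ∧ P[i]? = some w := by
  rw [List.getElem?_map]
  cases P[i]? <;> simp [and_comm, eq_comm]

lemma exists_append_of_getElem?_map {P : List (List Bool)} {p : Bool} {i : ℕ} {w : List Bool}
    (h : (P.map (· ++ [p]))[i]? = some w) : ∃ u, w = u ++ [p] ∧ P[i]? = some u := by
  rw [List.getElem?_map] at h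
  cases hP : P[i]? <;> simp_all

lemma consecutive_append {P Q : List (List Bool)} {p q b : Bool} (hpq : p ≠ q) {i : ℕ}
    {w w' : List Bool}
    (h1 : (P.map (· ++ [p]) ++ Q.map (· ++ [q]))[i]? = some (w ++ [b]))
    (h2 : (P.map (· ++ [p]) ++ Q.map (· ++ [q]))[i + 1]? = some w') :
    (∃ i' u, w' = u ++ [b] ∧ ((b = p ∧ P[i']? = some w ∧ P[i' + 1]? = some u) ∨
      (b = q ∧ Q[i']? = some w ∧ Q[i' + 1]? = some u))) ∨
    (b = p ∧ P.getLast? = some w ∧ ∃ u, Q.head? = some u ∧ w' = u ++ [q]) := by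
  rw [List.getElem?_append] at h1 h2
  simp only [List.length_map] at h1 h2
  split at h1
  · obtain ⟨rfl, h3⟩ := getElem?_map_append.1 h1
    split at h2
    · obtain ⟨u, rfl, h4⟩ := exists_append_of_getElem?_map h2
      exact Or.inl ⟨i, u, rfl, Or.inl ⟨rfl, h3, h4⟩⟩
    · obtain ⟨u, rfl, h4⟩ := exists_append_of_getElem?_map h2
      refine Or.inr ⟨rfl, ?_, u, ?_, rfl⟩
      · rw [List.getLast?_eq_getElem?, ← h3]; congr 1; omega
      · rw [List.head?_eq_getElem?, ← h4]; congr 1; omega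
  · rw [if_neg (by omega)] at h2
    obtain ⟨rfl, h3⟩ := getElem?_map_append.1 h1
    obtain ⟨u, rfl, h4⟩ := exists_append_of_getElem?_map h2
    refine Or.inl ⟨i - P.length, u, rfl, Or.inr ⟨rfl, h3, ?_⟩⟩
    rw [← h4]; congr 1; omega

lemma adicT_next {ξ : ℕ × ℕ → Bool} {δ : ℕ → Bool} (n i : ℕ) (w : List Bool)
    (h1 : (segList ξ (vertexAt δ n))[i]? = some (seg δ n))
    (h2 : (segList ξ (vertexAt δ n))[i + 1]? = some w) :
    seg (adicT ξ δ) n = w ∧ ∀ k, n ≤ k → adicT ξ δ k = δ k := by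
  induction n generalizing i w with
  | zero => simp [vertexAt, segList] at h2
  | succ n ih =>
    have hv := vertexAt_succ δ n
    have step : ∀ i' u, w = u ++ [δ n] →
        (segList ξ (vertexAt δ n))[i']? = some (seg δ n) →
        (segList ξ (vertexAt δ n))[i' + 1]? = some u →
        seg (adicT ξ δ) (n + 1) = w ∧ ∀ k, n + 1 ≤ k → adicT ξ δ k = δ k := by
      intro i' u hw h1 h2
      obtain ⟨h3, h4⟩ := ih i' u h1 h2
      exact ⟨by rw [seg_succ, h3, h4 n le_rfl, hw], fun k hk => h4 k (by omega)⟩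
    have last : ∀ x y, vertexAt δ (n + 1) = (x + 1, y + 1) → ∀ u b, δ n = (!ξ (x + 1, y + 1)) →
        (segList ξ (vertexAt δ n)).getLast? = some (seg δ n) →
        (segList ξ (if ξ (x + 1, y + 1) then (x + 1, y) else (x, y + 1))).head? = some u →
        b = ξ (x + 1, y + 1) → w = u ++ [b] →
        seg (adicT ξ δ) (n + 1) = w ∧ ∀ k, n + 1 ≤ k → adicT ξ δ k = δ k := by
      intro x y hxy u b hδ hl hh hb hw
      rw [getLast?_segList, Option.some_inj] at hl
      rw [head?_segList, Option.some_inj] at hh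
      have hmax := (seg_eq_maxPath_iff ξ δ n).1 hl.symm
      have hnmax : ¬ IsMaxEdge ξ δ n := by
        rw [IsMaxEdge, MoveMax, ← hv, hxy, hδ]
        simp
      obtain ⟨x', y', hw', -, htail', hn', hseg'⟩ := adicT_spec hmax hnmax
      obtain ⟨rfl, rfl⟩ : x' = x ∧ y' = y := by
        rw [hxy] at hw'; simp at hw'; omega
      exact ⟨by rw [seg_succ, hseg', hn', hw, hb, hh], fun k hk => htail' k hk⟩
    rw [seg_succ] at h1
    rcases childOf_cases (vertexAt δ n) (δ n) with ⟨x, hp, hm, hc⟩ | ⟨x, hp, hm, hc⟩ |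
      ⟨x, y, hp, hm, hc⟩ | ⟨x, y, hp, hm, hc⟩ <;> rw [hv, hc, segList] at h1 h2
    · obtain ⟨u, hw, h2⟩ := exists_append_of_getElem?_map h2
      obtain ⟨-, h1⟩ := getElem?_map_append.1 h1
      exact step i u (hm ▸ hw) (hp ▸ h1) (hp ▸ h2)
    · obtain ⟨u, hw, h2⟩ := exists_append_of_getElem?_map h2
      obtain ⟨-, h1⟩ := getElem?_map_append.1 h1
      exact step i u (hm ▸ hw) (hp ▸ h1) (hp ▸ h2)
    · specialize last x y (hv.trans hc)
      cases hx : ξ (x + 1, y + 1) <;> simp only [hx, if_true, if_false, Bool.false_eq_true] at h1 h2 last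
      all_goals
        rcases consecutive_append (by simp) h1 h2 with
          ⟨i', u, hw, ⟨hb, h1, h2⟩ | ⟨hb, h1, h2⟩⟩ | ⟨hb, h1, u, h2, hw⟩
      all_goals first
        | (exfalso; simp [hm] at hb; done)
        | exact step i' u hw (hp ▸ h1) (hp ▸ h2)
        | exact last u _ (by simp [hm]) (hp ▸ h1) h2 rfl hw
    · specialize last x y (hv.trans hc)
      cases hx : ξ (x + 1, y + 1) <;> simp only [hx, if_true, if_false, Bool.false_eq_true] at h1 h2 last
      all_goals
        rcases consecutive_append (by simp) h1 h2 with
          ⟨i', u, hw, ⟨hb, h1, h2⟩ | ⟨hb, h1, h2⟩⟩ | ⟨hb, h1, u, h2, hw⟩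
      all_goals first
        | (exfalso; simp [hm] at hb; done)
        | exact step i' u hw (hp ▸ h1) (hp ▸ h2)
        | exact last u _ (by simp [hm]) (hp ▸ h1) h2 rfl hw

lemma adicT_forall_isMinEdge {ξ : ℕ × ℕ → Bool} {δ : ℕ → Bool} {n : ℕ} (hδ : δ ∉ XMax ξ)
    (h : ∀ i < n, IsMaxEdge ξ δ i) : ∀ i < n, IsMinEdge ξ (adicT ξ δ) i := by
  obtain ⟨N, h1, h2⟩ := exists_first_not_isMaxEdge hδ
  obtain ⟨x, y, -, -, -, -, hseg⟩ := adicT_spec h1 h2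
  have hN : n ≤ N := not_lt.1 fun hlt => h2 (h N hlt)
  intro i hi
  exact (forall_isMinEdge_of_seg_eq hseg).2 i (by omega)

lemma forall_isMinEdge_iff_head {ξ : ℕ × ℕ → Bool} {δ : ℕ → Bool} {n : ℕ} :
    (∀ i < n, IsMinEdge ξ δ i) ↔ (segList ξ (vertexAt δ n))[0]? = some (seg δ n) := by
  rw [← List.head?_eq_getElem?, head?_segList, Option.some_inj, ← seg_eq_minPath_iff, eq_comm]

lemma not_forall_isMinEdge_of_pos {ξ : ℕ × ℕ → Bool} {δ : ℕ → Bool} {n i : ℕ} (hi : 0 < i)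
    (h : (segList ξ (vertexAt δ n))[i]? = some (seg δ n)) : ¬ ∀ i < n, IsMinEdge ξ δ i := by
  rw [forall_isMinEdge_iff_head, ← h]
  intro h'
  have := (List.getElem?_inj (length_segList_pos ξ _) (nodup_segList ξ _)).1 h'
  omega

lemma adicIter_passage {ξ : ℕ × ℕ → Bool} {γ : ℕ → Bool} (hγ : γ ∉ XPrime ξ) {n : ℕ} {s : ℤ}
    {v : ℕ × ℕ} {i : ℕ} (hv : vertexAt (adicIter ξ s γ) n = v)
    (hi : (segList ξ v)[i]? = some (seg (adicIter ξ s γ) n)) (r : ℕ)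
    (hr : i + r < (segList ξ v).length) :
    (segList ξ v)[i + r]? = some (seg (adicIter ξ (s + r) γ) n) ∧
      vertexAt (adicIter ξ (s + r) γ) n = v := by
  induction r with
  | zero => simpa using ⟨hi, hv⟩
  | succ r ih =>
    obtain ⟨h1, h2⟩ := ih (by omega)
    have e : s + ((r + 1 : ℕ) : ℤ) = s + r + 1 := by push_cast; ring
    rw [e, adicIter_add_one hγ]
    have h3 : (segList ξ v)[i + r + 1]? = some _ := List.getElem?_eq_getElem hr
    obtain ⟨h4, -⟩ := adicT_next n (i + r) (segList ξ v)[i + r + 1] (by rw [h2]; exact h1)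
      (by rw [h2]; exact h3)
    rw [vertexAt_eq_endpoint, h4]
    exact ⟨h3, endpoint_of_mem_segList (List.getElem_mem hr)⟩

lemma adicIter_passage_end {ξ : ℕ × ℕ → Bool} {γ : ℕ → Bool} (hγ : γ ∉ XPrime ξ) {n : ℕ} {s : ℤ}
    {v : ℕ × ℕ} {i : ℕ} (hv : vertexAt (adicIter ξ s γ) n = v)
    (hi : (segList ξ v)[i]? = some (seg (adicIter ξ s γ) n)) (r : ℕ)
    (hr : i + r = (segList ξ v).length) :
    ∀ l < n, IsMinEdge ξ (adicIter ξ (s + r) γ) l := by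
  have hil : i < (segList ξ v).length := by
    by_contra h
    rw [List.getElem?_eq_none (by omega)] at hi
    simp at hi
  obtain ⟨r, rfl⟩ : ∃ r', r = r' + 1 := ⟨r - 1, by omega⟩
  obtain ⟨h1, h2⟩ := adicIter_passage hγ hv hi r (by omega)
  have e : s + ((r + 1 : ℕ) : ℤ) = s + r + 1 := by push_cast; ring
  rw [e, adicIter_add_one hγ]
  apply adicT_forall_isMinEdge (notMem_XMax_of_notMem_XPrime (adicIter_notMem_XPrime hγ _))
  rw [← seg_eq_maxPath_iff, h2, ← Option.some_inj, ← h1, ← getLast?_segList,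
    List.getLast?_eq_getElem?]
  congr 1
  omega

lemma natCuts_passage {ξ : ℕ × ℕ → Bool} {γ : ℕ → Bool} (hγ : γ ∉ XPrime ξ) {n : ℕ} {s : ℤ}
    {v : ℕ × ℕ} (hv : vertexAt (adicIter ξ s γ) n = v)
    (hs : ∀ i < n, IsMinEdge ξ (adicIter ξ s γ) i) :
    (∀ r < (segList ξ v).length, (segList ξ v)[r]? = some (seg (adicIter ξ (s + r) γ) n)) ∧
    (∀ i < n, IsMinEdge ξ (adicIter ξ (s + (segList ξ v).length) γ) i) ∧
    ∀ u, s < u → u < s + (segList ξ v).length → ¬ ∀ i < n, IsMinEdge ξ (adicIter ξ u γ) i := by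
  have h0 := forall_isMinEdge_iff_head.1 hs
  rw [hv] at h0
  have hp : ∀ r < (segList ξ v).length,
      (segList ξ v)[r]? = some (seg (adicIter ξ (s + r) γ) n) ∧
        vertexAt (adicIter ξ (s + r) γ) n = v := by
    intro r hr
    simpa using adicIter_passage hγ hv h0 r (by omega)
  refine ⟨fun r hr => (hp r hr).1, adicIter_passage_end hγ hv h0 _ (by simp), ?_⟩
  intro u h1 h2
  obtain ⟨r, rfl⟩ : ∃ r : ℕ, u = s + r := ⟨(u - s).toNat, by omega⟩
  obtain ⟨h3, h4⟩ := hp r (by omega)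
  exact not_forall_isMinEdge_of_pos (i := r) (by omega) (by rw [h4]; exact h3)

lemma exists_natCut_gt {ξ : ℕ × ℕ → Bool} {γ : ℕ → Bool} (hγ : γ ∉ XPrime ξ) (n : ℕ) (t : ℤ) :
    ∃ u, t < u ∧ u ≤ t + 2 ^ n ∧ ∀ i < n, IsMinEdge ξ (adicIter ξ u γ) i := by
  obtain ⟨i, hi, h⟩ := List.getElem_of_mem (seg_mem_segList ξ (adicIter ξ t γ) n)
  have hle := length_segList_le ξ (vertexAt (adicIter ξ t γ) n)
  rw [vertexAt_sum] at hle
  have hle' : ((segList ξ (vertexAt (adicIter ξ t γ) n)).length : ℤ) ≤ 2 ^ n := by exact_mod_cast hle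
  refine ⟨_, ?_, ?_, adicIter_passage_end hγ (n := n) (s := t) (i := i) rfl
    (by rw [← h]; exact List.getElem?_eq_getElem hi)
    ((segList ξ (vertexAt (adicIter ξ t γ) n)).length - i) (by omega)⟩
  · omega
  · omega

lemma wordAt_eq (ω : ℤ → List Bool) (s t : ℤ) :
    wordAt ω s t = (List.range (t - s).toNat).map fun u : ℕ => ω (s + u) := by
  have : (List.range (t - s).toNat).flatMap (fun a : ℕ => [(a : ℤ)]) =
      (List.range (t - s).toNat).map (fun a : ℕ => (a : ℤ)) := List.map_eq_flatMap.symm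
  change List.map _ ((List.range (t - s).toNat).flatMap (fun a : ℕ => [(a : ℤ)])) = _
  rw [this, List.map_map]
  rfl

lemma wordAt_natCuts {ξ : ℕ × ℕ → Bool} {γ : ℕ → Bool} {k n : ℕ} (hk : k ≤ n) {s : ℤ}
    {v : ℕ × ℕ} (hv : vertexAt (adicIter ξ s γ) n = v)
    (h : ∀ r < (segList ξ v).length,
      (segList ξ v)[r]? = some (seg (adicIter ξ (s + r) γ) n)) :
    wordAt (omegaCode ξ k γ) s (s + (segList ξ v).length) = codedBlock ξ k v := by
  have hsum := vertexAt_sum (adicIter ξ s γ) n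
  rw [hv] at hsum
  rw [codedBlock_eq_map_take _ _ _ (by omega)]
  apply List.ext_getElem
  · simp [wordAt_eq]
  · intro r h1 h2
    have h3 : r < (segList ξ v).length := by simpa using h2
    have h4 := h r h3
    rw [List.getElem?_eq_getElem h3, Option.some_inj] at h4
    simp [wordAt_eq, omegaCode, h4, seg, ← List.map_take, List.take_range, hk]

lemma natScheme_isConsistent {ξ : ℕ × ℕ → Bool} {γ : ℕ → Bool} (hγ : γ ∉ XPrime ξ) (k : ℕ) :
    IsConsistentScheme ξ k (omegaCode ξ k γ) (natCuts ξ k γ) (natVert ξ k γ) := by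
  have hnext : ∀ j : ℕ, ∀ s ∈ natCuts ξ k γ j, ∀ t ∈ natCuts ξ k γ j, s < t →
      (∀ u ∈ natCuts ξ k γ j, ¬(s < u ∧ u < t)) →
      t = s + (segList ξ (natVert ξ k γ j s)).length := by
    intro j s hs t ht hst hu
    obtain ⟨-, h2, h3⟩ := natCuts_passage hγ (n := k + j) (s := s) rfl hs
    have hpos := length_segList_pos ξ (natVert ξ k γ j s)
    have h4 : ¬ (s < s + ((segList ξ (natVert ξ k γ j s)).length : ℤ) ∧
      s + ((segList ξ (natVert ξ k γ j s)).length : ℤ) < t) := hu _ h2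
    have h5 : ¬ t < s + ((segList ξ (natVert ξ k γ j s)).length : ℤ) := fun h => h3 t hst h ht
    omega
  refine ⟨?_, ?_, ?_, ?_, ?_⟩
  · intro j M
    obtain ⟨u, h1, h2, h3⟩ := exists_natCut_gt hγ (k + j) (M - 1 - 2 ^ (k + j))
    exact ⟨u, h3, by omega⟩
  · intro j M
    obtain ⟨u, h1, h2, h3⟩ := exists_natCut_gt hγ (k + j) M
    exact ⟨u, h3, h1⟩
  · intro j s hs t ht hst hu
    refine ⟨vertexAt_sum _ _, ?_⟩
    rw [hnext j s hs t ht hst hu]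
    exact wordAt_natCuts (n := k + j) (by omega) rfl (natCuts_passage hγ rfl hs).1
  · intro j s hs i hi
    exact hs i (by omega)
  · intro j s hs t ht hst hu x y hv
    have ht' := hnext (j + 1) s hs t ht hst hu
    obtain ⟨h1, -, -⟩ := natCuts_passage hγ (n := k + (j + 1)) (s := s) hv hs
    rw [hv] at ht'
    have key : ∀ (p q : Bool) (a b : ℕ × ℕ), segList ξ (x + 1, y + 1) =
        (segList ξ a).map (· ++ [p]) ++ (segList ξ b).map (· ++ [q]) →
        ∃ m ∈ natCuts ξ k γ j, s < m ∧ m < t ∧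
          (∀ u ∈ natCuts ξ k γ j, s < u → u < t → u = m) ∧
          natVert ξ k γ j s = a ∧ natVert ξ k γ j m = b := by
      intro p q a b hab
      have ha := length_segList_pos ξ a
      have hb := length_segList_pos ξ b
      rw [hab] at h1 ht'
      simp only [List.length_append, List.length_map] at h1 ht'
      have e1 := h1 0 (by omega)
      rw [← add_assoc k j 1, seg_succ, List.getElem?_append_left (by simpa)] at e1
      obtain ⟨-, e1⟩ := getElem?_map_append.1 e1
      rw [← List.head?_eq_getElem?, head?_segList, Option.some_inj] at e1
      have e2 := h1 (segList ξ a).length (by omega)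
      rw [← add_assoc k j 1, seg_succ, List.getElem?_append_right (by simp)] at e2
      obtain ⟨-, e2⟩ := getElem?_map_append.1 e2
      simp only [List.length_map, Nat.sub_self] at e2
      rw [← List.head?_eq_getElem?, head?_segList, Option.some_inj] at e2
      simp only [Nat.cast_zero, add_zero] at e1
      obtain ⟨va, ma⟩ := forall_isMinEdge_of_seg_eq e1.symm
      obtain ⟨vb, mb⟩ := forall_isMinEdge_of_seg_eq e2.symm
      obtain ⟨-, -, na⟩ := natCuts_passage hγ va ma
      obtain ⟨-, -, nb⟩ := natCuts_passage hγ vb mb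
      push_cast at ht'
      refine ⟨s + (segList ξ a).length, mb, by omega, by omega, ?_, va, vb⟩
      intro u hu' h2 h3
      have h4 : ¬ u < s + (segList ξ a).length := fun h => na u h2 h hu'
      have h5 : ¬ s + (segList ξ a).length < u := fun h => nb u h (by omega) hu'
      omega
    split
    · obtain ⟨m, c1, c2, c3, c4, c5⟩ := key false true (x, y + 1) (x + 1, y)
        (by rw [segList, if_pos ‹_›])
      exact ⟨m, c1, c2, c3, c4, c5⟩
    · obtain ⟨m, c1, c2, c3, c4, c5⟩ := key true false (x + 1, y) (x, y + 1)
        (by rw [segList, if_neg ‹_›])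
      exact ⟨m, c1, c2, c3, c4, c5⟩

/-- `F` marks the starting positions of a factorization into single letters and pairs of a
sequence with labels `m i ∈ {0, …, N}`; the new blocks have labels `M i ∈ {0, …, N + 1}` and can
themselves be grouped at the next level. -/
structure IsGrouping (N : ℤ) (R : ℤ → ℤ → Prop) (m M : ℤ → ℤ) (F : ℤ → Prop) : Prop where
  step : ∀ i, F i → (F (i + 1) ∧ ((m i = 0 ∧ M i = 0) ∨ (m i = N ∧ M i = N + 1))) ∨
    (¬ F (i + 1) ∧ F (i + 2) ∧ R (m i) (m (i + 1)) ∧ M i = max (m i) (m (i + 1)))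
  left : ∀ i, ¬ F (i + 1) → F i
  neighbor : ∀ i, F i → M i ≠ 0 → M i ≠ N + 1 → ∃ i', F i' ∧ (M i = M i' + 1 ∨ M i' = M i + 1) ∧
    ((i < i' ∧ ∀ u, i < u → u < i' → ¬ F u) ∨ (i' < i ∧ ∀ u, i' < u → u < i → ¬ F u))

namespace IsGrouping

variable {N : ℤ} {R : ℤ → ℤ → Prop} {m M M' : ℤ → ℤ} {A B : ℤ → Prop}

lemma rel_of_not (hA : IsGrouping N R m M A) {i : ℤ} (h : ¬ A (i + 1)) :
    A i ∧ A (i + 2) ∧ R (m i) (m (i + 1)) := by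
  have h1 := hA.left i h
  rcases hA.step i h1 with h2 | h2
  · exact absurd h2.1 h
  · exact ⟨h1, h2.2.1, h2.2.2.1⟩

lemma reflect (hR : ∀ a b, R a b → b = a + 1 ∨ a = b + 1) (hA : IsGrouping N R m M A) :
    IsGrouping N (fun a b => R (N - a) (N - b)) (fun i => N - m i) (fun i => N + 1 - M i) A where
  step i hi := by
    rcases hA.step i hi with ⟨h1, h2⟩ | ⟨h1, h2, h3, h4⟩
    · left; refine ⟨h1, ?_⟩; omega
    · right
      refine ⟨h1, h2, by simpa using h3, ?_⟩
      have := hR _ _ h3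
      omega
  left := hA.left
  neighbor i hi h0 h1 := by
    obtain ⟨i', h2, h3, h4⟩ := hA.neighbor i hi (by omega) (by omega)
    exact ⟨i', h2, by omega, h4⟩

lemma false_of_ascending_zero (hN : 3 ≤ N) (hR : ∀ a b, R a b → b = a + 1 ∨ a = b + 1)
    (hR' : ∀ a b, R a b → ¬ R b a) (hm : ∀ i, 0 ≤ m i)
    (hA : IsGrouping N R m M A) (hB : IsGrouping N R m M' B) {i : ℤ}
    (hAi : A (i + 1)) (hBi : ¬ B (i + 1)) (h0 : m i = 0) (h1 : m (i + 1) = 1) : False := by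
  obtain ⟨b0, b2, r01⟩ := hB.rel_of_not hBi
  rw [h0, h1] at r01
  have e2 : i + 1 + 1 = i + 2 := by ring
  have e3 : i + 1 + 2 = i + 3 := by ring
  have e3' : i + 2 + 1 = i + 3 := by ring
  have e4 : i + 3 + 1 = i + 4 := by ring
  obtain ⟨na2, a3, r12, hM1⟩ := (hA.step _ hAi).resolve_left (by omega)
  rw [e2] at na2 r12 hM1
  rw [e3] at a3
  have h2 : m (i + 2) = 2 := by
    rcases hR _ _ r12 with h | h
    · omega
    · rw [show m (i + 2) = 0 by omega, h1] at r12
      exact absurd r12 (hR' _ _ r01)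
  obtain ⟨nb3, -, r23, -⟩ := (hB.step _ b2).resolve_left (by omega)
  rw [e3'] at r23
  have h3 : m (i + 3) = 3 := by
    rcases hR _ _ r23 with h | h
    · omega
    · rw [show m (i + 3) = m (i + 1) by omega] at r23
      exact absurd r12 (hR' _ _ r23)
  obtain ⟨i', ai', hdiff, ⟨hlt, hno⟩ | ⟨hlt, hno⟩⟩ := hA.neighbor _ hAi (by omega) (by omega)
  · have : i' = i + 3 := by
      have h4 : ¬ i + 3 < i' := fun h => hno (i + 3) (by omega) h a3
      have h5 : i' ≠ i + 2 := by rintro rfl; exact na2 ai'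
      omega
    subst this
    rcases hA.step _ a3 with ⟨-, h⟩ | ⟨-, -, r34, hM⟩
    · omega
    · rw [e4] at r34 hM
      rcases hR _ _ r34 with h | h
      · omega
      · rw [show m (i + 4) = m (i + 2) by omega] at r34
        exact hR' _ _ r34 r23
  · have a0 : A i := by
      by_contra h
      obtain ⟨-, -, r⟩ := hA.rel_of_not (i := i - 1) (by simpa using h)
      rw [sub_add_cancel] at r
      have := hm (i - 1)
      rcases hR _ _ r with h' | h'
      · omega
      · rw [show m (i - 1) = 1 by omega, h0] at r
        exact hR' _ _ r r01
    have : i' = i := by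
      have h4 : ¬ i' < i := fun h => hno i h (by omega) a0
      omega
    subst this
    rcases hA.step _ a0 with ⟨-, h⟩ | ⟨h, -⟩
    · omega
    · exact h hAi

lemma false_of_ascending (hN : 3 ≤ N) (hR : ∀ a b, R a b → b = a + 1 ∨ a = b + 1)
    (hR' : ∀ a b, R a b → ¬ R b a) (hm : ∀ i, 0 ≤ m i) (hmN : ∀ i, m i ≤ N)
    (hA : IsGrouping N R m M A) (hB : IsGrouping N R m M' B) {i : ℤ} (k : ℕ)
    (hAi : A (i + 1)) (hBi : ¬ B (i + 1)) (hk : m i = k) (h1 : m (i + 1) = m i + 1) : False := by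
  induction k generalizing i M M' A B with
  | zero => exact false_of_ascending_zero hN hR hR' hm hA hB hAi hBi (by simpa using hk) (by omega)
  | succ k ih =>
    obtain ⟨b0, -, r⟩ := hB.rel_of_not hBi
    have na : ¬ A i := by
      intro h
      rcases hA.step _ h with ⟨-, h⟩ | ⟨h, -⟩
      · have := hmN (i + 1)
        omega
      · exact h hAi
    obtain ⟨-, -, r'⟩ := hA.rel_of_not (i := i - 1) (by simpa using na)
    rw [sub_add_cancel] at r'
    rcases hR _ _ r' with h | h
    · exact ih hB hA (i := i - 1) (by simpa using b0) (by simpa using na) (by omega)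
        (by simpa using h)
    · rw [show m (i - 1) = m (i + 1) by omega] at r'
      exact hR' _ _ r r'

lemma imp_of_isGrouping (hN : 3 ≤ N) (hR : ∀ a b, R a b → b = a + 1 ∨ a = b + 1)
    (hR' : ∀ a b, R a b → ¬ R b a) (hm : ∀ i, 0 ≤ m i) (hmN : ∀ i, m i ≤ N)
    (hA : IsGrouping N R m M A) (hB : IsGrouping N R m M' B) (i : ℤ) (h : A i) : B i := by
  by_contra hn
  obtain ⟨i, rfl⟩ : ∃ i', i = i' + 1 := ⟨i - 1, by ring⟩
  have hmi := hm i
  have hmNi := hmN i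
  rcases hR _ _ (hB.rel_of_not hn).2.2 with h1 | h1
  · exact false_of_ascending hN hR hR' hm hmN hA hB (m i).toNat h hn (by omega) h1
  · refine false_of_ascending hN (R := fun a b => R (N - a) (N - b)) (m := fun i => N - m i) ?_
      (fun a b => hR' _ _) (fun i => ?_) (fun i => ?_) (hA.reflect hR) (hB.reflect hR)
      (N - m i).toNat h hn ?_ ?_
    · intro a b hab
      have := hR _ _ hab
      omega
    · have := hmN i
      omega
    · have := hm i
      omega
    · omega
    · omega

lemma label_eq (hN : N ≠ 0) (hA : IsGrouping N R m M A) (hB : IsGrouping N R m M' A) {i : ℤ}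
    (h : A i) : M i = M' i := by
  rcases hA.step i h with ⟨h1, h2⟩ | ⟨h1, -, -, h2⟩ <;>
    rcases hB.step i h with ⟨h3, h4⟩ | ⟨h3, -, -, h4⟩
  · omega
  · exact absurd h1 h3
  · exact absurd h3 h1
  · omega

end IsGrouping

lemma exists_strictMono_range_eq {C : Set ℤ} (h1 : ∀ M, ∃ s ∈ C, s < M) (h2 : ∀ M, ∃ t ∈ C, M < t) :
    ∃ e : ℤ → ℤ, StrictMono e ∧ Set.range e = C := by
  classical
  have : Nonempty C := by
    obtain ⟨s, hs, -⟩ := h1 0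
    exact ⟨⟨s, hs⟩⟩
  have : NoMaxOrder C := ⟨fun a => by
    obtain ⟨t, ht, h⟩ := h2 a
    exact ⟨⟨t, ht⟩, h⟩⟩
  have : NoMinOrder C := ⟨fun a => by
    obtain ⟨t, ht, h⟩ := h1 a
    exact ⟨⟨t, ht⟩, h⟩⟩
  let : LocallyFiniteOrder C := Subtype.instLocallyFiniteOrder _
  let := LinearLocallyFiniteOrder.succOrder C
  let := LinearLocallyFiniteOrder.predOrder C
  let f : C ≃o ℤ := orderIsoIntOfLinearSuccPredArch
  refine ⟨fun i => f.symm i, fun a b h => f.symm.strictMono h, ?_⟩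
  ext x
  constructor
  · rintro ⟨i, rfl⟩
    exact (f.symm i).2
  · intro hx
    exact ⟨f ⟨x, hx⟩, by simp⟩

lemma exists_next {C : Set ℤ} (h2 : ∀ M, ∃ t ∈ C, M < t) (s : ℤ) :
    ∃ t ∈ C, s < t ∧ ∀ u ∈ C, ¬ (s < u ∧ u < t) := by
  obtain ⟨t0, ht0, hlt⟩ := h2 s
  obtain ⟨t, ⟨h3, h4⟩, h5⟩ := Int.exists_least_of_bdd (P := fun t => t ∈ C ∧ s < t)
    ⟨s, fun z hz => hz.2.le⟩ ⟨t0, ht0, hlt⟩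
  refine ⟨t, h3, h4, fun u hu h => ?_⟩
  have := h5 u ⟨hu, h.1⟩
  omega

lemma exists_greatest_le {C : Set ℤ} (h1 : ∀ M, ∃ s ∈ C, s < M) (t : ℤ) :
    ∃ s ∈ C, s ≤ t ∧ ∀ u ∈ C, u ≤ t → u ≤ s := by
  obtain ⟨s0, hs0, hlt⟩ := h1 t
  obtain ⟨s, ⟨h3, h4⟩, h5⟩ := Int.exists_greatest_of_bdd (P := fun s => s ∈ C ∧ s ≤ t)
    ⟨t, fun z hz => hz.2⟩ ⟨s0, hs0, hlt.le⟩
  exact ⟨s, h3, h4, fun u hu h => h5 u ⟨hu, h⟩⟩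

lemma codedBlock_zero_right {ξ : ℕ × ℕ → Bool} {k x : ℕ} (h : k ≤ x) :
    codedBlock ξ k (x, 0) = [List.replicate k false] := by
  rw [codedBlock_eq_map_take _ _ _ (by simpa), segList_zero_right]
  simp [h]

lemma codedBlock_zero_left {ξ : ℕ × ℕ → Bool} {k y : ℕ} (h : k ≤ y) :
    codedBlock ξ k (0, y) = [List.replicate k true] := by
  rw [codedBlock_eq_map_take _ _ _ (by simpa), segList_zero_left]
  simp [h]

lemma one_lt_length_codedBlock {ξ : ℕ × ℕ → Bool} {k x y : ℕ} (h : k ≤ (x + 1) + (y + 1)) :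
    1 < (codedBlock ξ k (x + 1, y + 1)).length := by
  rw [codedBlock_eq_map_take _ _ _ (by simpa), segList]
  have h1 := length_segList_pos ξ (x, y + 1)
  have h2 := length_segList_pos ξ (x + 1, y)
  split <;> simp <;> omega

lemma eq_of_codedBlock_eq_false {ξ : ℕ × ℕ → Bool} {k : ℕ} (hk : 0 < k) {v : ℕ × ℕ}
    (hv : k ≤ v.1 + v.2) (h : codedBlock ξ k v = [List.replicate k false]) : v.2 = 0 := by
  obtain ⟨_ | x, _ | y⟩ := v
  · rfl
  · rw [codedBlock_zero_left (by simpa using hv)] at h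
    obtain ⟨k, rfl⟩ : ∃ l, k = l + 1 := ⟨k - 1, by omega⟩
    simp [List.replicate_succ] at h
  · rfl
  · have := one_lt_length_codedBlock (ξ := ξ) hv
    simp [h] at this

lemma eq_of_codedBlock_eq_true {ξ : ℕ × ℕ → Bool} {k : ℕ} (hk : 0 < k) {v : ℕ × ℕ}
    (hv : k ≤ v.1 + v.2) (h : codedBlock ξ k v = [List.replicate k true]) : v.1 = 0 := by
  obtain ⟨_ | x, _ | y⟩ := v
  · rfl
  · rfl
  · rw [codedBlock_zero_right (by simpa using hv)] at h
    obtain ⟨k, rfl⟩ : ∃ l, k = l + 1 := ⟨k - 1, by omega⟩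
    simp [List.replicate_succ] at h
  · have := one_lt_length_codedBlock (ξ := ξ) hv
    simp [h] at this

namespace IsConsistentScheme

variable {ξ : ℕ × ℕ → Bool} {k : ℕ} {ω : ℤ → List Bool} {cuts : ℕ → Set ℤ}
  {vert : ℕ → ℤ → ℕ × ℕ}

/-- The labels `a`, `b` of two consecutive blocks over level `N` that are joined at the next
level, in the order prescribed by `ξ`. -/
def LabelRel (ξ : ℕ × ℕ → Bool) (N : ℕ) (a b : ℤ) : Prop :=
  ∃ x y : ℕ, x + y + 1 = N ∧
    ((ξ (x + 1, y + 1) = true ∧ a = y + 1 ∧ b = y) ∨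
      (ξ (x + 1, y + 1) = false ∧ a = y ∧ b = y + 1))

lemma LabelRel.adjacent {N : ℕ} {a b : ℤ} (h : LabelRel ξ N a b) : b = a + 1 ∨ a = b + 1 := by
  obtain ⟨x, y, -, ⟨-, h1, h2⟩ | ⟨-, h1, h2⟩⟩ := h <;> omega

lemma LabelRel.asymm {N : ℕ} {a b : ℤ} (h : LabelRel ξ N a b) : ¬ LabelRel ξ N b a := by
  rintro ⟨x', y', h1', h'⟩
  obtain ⟨x, y, h1, h⟩ := h
  rcases h with ⟨h, h2, h3⟩ | ⟨h, h2, h3⟩ <;> rcases h' with ⟨h', h4, h5⟩ | ⟨h', h4, h5⟩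
  · omega
  · obtain rfl : y' = y := by omega
    obtain rfl : x' = x := by omega
    simp [h] at h'
  · obtain rfl : y' = y := by omega
    obtain rfl : x' = x := by omega
    simp [h] at h'
  · omega

lemma vert_sum (h : IsConsistentScheme ξ k ω cuts vert) {j : ℕ} {s : ℤ} (hs : s ∈ cuts j) :
    (vert j s).1 + (vert j s).2 = k + j := by
  obtain ⟨t, ht, hst, hno⟩ := exists_next (h.2.1 j) s
  exact (h.2.2.1 j s hs t ht hst hno).1

lemma length_wordAt (ω : ℤ → List Bool) (s t : ℤ) : (wordAt ω s t).length = (t - s).toNat := by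
  simp [wordAt_eq]

lemma grouping_step (h : IsConsistentScheme ξ k ω cuts vert) (hk : 0 < k) {j : ℕ} {e : ℤ → ℤ}
    (he : StrictMono e) (hr : Set.range e = cuts j) {i : ℤ} (hi : e i ∈ cuts (j + 1)) :
    (e (i + 1) ∈ cuts (j + 1) ∧
      ((((vert j (e i)).2 : ℤ) = 0 ∧ ((vert (j + 1) (e i)).2 : ℤ) = 0) ∨
        (((vert j (e i)).2 : ℤ) = (k + j : ℕ) ∧
          ((vert (j + 1) (e i)).2 : ℤ) = (k + j : ℕ) + 1))) ∨
    (e (i + 1) ∉ cuts (j + 1) ∧ e (i + 2) ∈ cuts (j + 1) ∧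
      LabelRel ξ (k + j) (vert j (e i)).2 (vert j (e (i + 1))).2 ∧
      ((vert (j + 1) (e i)).2 : ℤ) = max ((vert j (e i)).2 : ℤ) (vert j (e (i + 1))).2) := by
  obtain ⟨t, ht, hst, hno⟩ := exists_next (h.2.1 (j + 1)) (e i)
  obtain ⟨hsum, hword⟩ := h.2.2.1 (j + 1) _ hi t ht hst hno
  have hmem : ∀ i, e i ∈ cuts j := fun i => hr ▸ Set.mem_range_self i
  have hsum' := h.vert_sum (hmem i)
  obtain ⟨i', rfl⟩ : t ∈ Set.range e := hr ▸ h.2.2.2.1 j ht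
  have hlt : i < i' := he.lt_iff_lt.1 hst
  have hnext : e i < e (i + 1) := he (by omega)
  have single : ∀ b, codedBlock ξ k (vert (j + 1) (e i)) = [List.replicate k b] →
      e (i + 1) ∈ cuts (j + 1) ∧ codedBlock ξ k (vert j (e i)) = [List.replicate k b] := by
    intro b hb
    rw [hb] at hword
    have hl := congrArg List.length hword
    rw [length_wordAt, List.length_singleton] at hl
    have : i' = i + 1 := by
      have h1 : ¬ i + 1 < i' := fun h1 => by
        have := he h1
        omega
      omega
    subst this
    refine ⟨ht, ?_⟩
    rw [← hword]
    refine (h.2.2.1 j _ (hmem i) _ (hmem _) hst ?_).2.symm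
    intro u _ hu
    omega
  rcases hv : vert (j + 1) (e i) with ⟨_ | x, _ | y⟩
  · simp [hv] at hsum
  · rw [hv] at hsum single
    simp only at hsum
    obtain ⟨h1, h2⟩ := single true (codedBlock_zero_left (by omega))
    have h3 := eq_of_codedBlock_eq_true hk (by omega) h2
    exact Or.inl ⟨h1, Or.inr ⟨by omega, by simp only; omega⟩⟩
  · rw [hv] at hsum single
    simp only at hsum
    obtain ⟨h1, h2⟩ := single false (codedBlock_zero_right (by omega))
    have h3 := eq_of_codedBlock_eq_false hk (by omega) h2
    exact Or.inl ⟨h1, Or.inl ⟨by omega, by simp⟩⟩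
  · obtain ⟨p, hp, hp1, hp2, hp3, hp4⟩ := h.2.2.2.2 j _ hi _ ht hst hno x y hv
    rw [hv] at hsum
    simp only at hsum
    obtain ⟨p, rfl⟩ : p ∈ Set.range e := hr ▸ hp
    rw [he.lt_iff_lt] at hp1 hp2
    have e1 : e (i + 1) = e p := hp3 _ (hmem _) hnext (he (by omega))
    obtain rfl : i + 1 = p := he.injective e1
    have : i' = i + 2 := by
      by_contra hne
      have e2 := he.injective (hp3 (e (i + 2)) (hmem _) (he (by omega)) (he (by omega)))
      omega
    subst this
    refine Or.inr ⟨fun hc => hno _ hc ⟨he hp1, he hp2⟩, ht, ?_⟩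
    split at hp4
    · rw [hp4.1, hp4.2]
      exact ⟨⟨x, y, by omega, Or.inl ⟨‹_›, by simp, rfl⟩⟩, by simp⟩
    · rw [hp4.1, hp4.2]
      exact ⟨⟨x, y, by omega, Or.inr ⟨Bool.eq_false_iff.2 ‹_›, rfl, by simp⟩⟩, by simp⟩

lemma grouping_left (h : IsConsistentScheme ξ k ω cuts vert) (hk : 0 < k) {j : ℕ} {e : ℤ → ℤ}
    (he : StrictMono e) (hr : Set.range e = cuts j) {i : ℤ} (hi : e (i + 1) ∉ cuts (j + 1)) :
    e i ∈ cuts (j + 1) := by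
  obtain ⟨s, hs, hsi, hmax⟩ := exists_greatest_le (h.1 (j + 1)) (e i)
  obtain ⟨p, rfl⟩ : s ∈ Set.range e := hr ▸ h.2.2.2.1 j hs
  rw [he.le_iff_le] at hsi
  have hmax' : ∀ q, e q ∈ cuts (j + 1) → q ≤ i → q ≤ p := fun q hq hqi =>
    he.le_iff_le.1 (hmax _ hq (he.monotone hqi))
  rcases h.grouping_step hk he hr hs with ⟨h1, -⟩ | ⟨-, h1, -⟩
  · have h2 := hmax' _ h1
    obtain rfl : p = i := by omega
    exact hs
  · have h2 := hmax' _ h1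
    rcases eq_or_ne p i with rfl | hne
    · exact hs
    · obtain rfl : p = i - 1 := by omega
      rw [show i - 1 + 2 = i + 1 by ring] at h1
      exact absurd h1 hi

lemma isGrouping (h : IsConsistentScheme ξ k ω cuts vert) (hk : 0 < k) {j : ℕ} {e : ℤ → ℤ}
    (he : StrictMono e) (hr : Set.range e = cuts j) :
    IsGrouping (k + j : ℕ) (LabelRel ξ (k + j)) (fun i => (vert j (e i)).2)
      (fun i => (vert (j + 1) (e i)).2) (fun i => e i ∈ cuts (j + 1)) where
  step i hi := h.grouping_step hk he hr hi
  left i hi := h.grouping_left hk he hr hi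
  neighbor i hi h0 h1 := by
    obtain ⟨f, hf, hfr⟩ := exists_strictMono_range_eq (h.1 (j + 1)) (h.2.1 (j + 1))
    have hmem : ∀ i, f i ∈ cuts (j + 1) := fun i => hfr ▸ Set.mem_range_self i
    have hex : ∀ p, ∃ i, e i = f p := fun p => by
      have : f p ∈ Set.range e := hr ▸ h.2.2.2.1 j (hmem p)
      exact this
    have hgap : ∀ p u, e u ∈ cuts (j + 1) → f p < e u → e u < f (p + 1) → False := by
      intro p u hu h1 h2
      obtain ⟨q, hq⟩ : e u ∈ Set.range f := hfr ▸ hu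
      rw [← hq, hf.lt_iff_lt] at h1 h2
      omega
    obtain ⟨p, hp⟩ : e i ∈ Set.range f := hfr ▸ hi
    have hstep := fun q => h.grouping_step hk hf hfr (i := q)
    by_cases hG : f p ∈ cuts (j + 1 + 1)
    · rcases hstep p hG with ⟨-, h2⟩ | ⟨-, -, h2, -⟩
      · rw [hp] at h2
        push_cast at h0 h1 h2
        omega
      · obtain ⟨i', hi'⟩ := hex (p + 1)
        have hadj := h2.adjacent
        rw [hp, ← hi'] at hadj
        have hlt : f p < f (p + 1) := hf (by omega)
        refine ⟨i', hi' ▸ hmem _, by omega, Or.inl ⟨?_, ?_⟩⟩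
        · rwa [hp, ← hi', he.lt_iff_lt] at hlt
        · intro u h3 h4 hu
          exact hgap p u hu (hp ▸ he h3) (hi' ▸ he h4)
    · have hG' : f (p - 1) ∈ cuts (j + 1 + 1) :=
        h.grouping_left hk hf hfr (by simpa using hG)
      rcases hstep _ hG' with ⟨h2, -⟩ | ⟨-, -, h2, -⟩
      · exact absurd (by simpa using h2) hG
      · obtain ⟨i', hi'⟩ := hex (p - 1)
        have hadj := h2.adjacent
        rw [sub_add_cancel, hp, ← hi'] at hadj
        have hlt : f (p - 1) < f p := hf (by omega)
        refine ⟨i', hi' ▸ hmem _, by omega, Or.inr ⟨?_, ?_⟩⟩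
        · rwa [hp, ← hi', he.lt_iff_lt] at hlt
        · intro u h3 h4 hu
          exact hgap (p - 1) u hu (hi' ▸ he h3) (by rw [sub_add_cancel, hp]; exact he h4)

lemma mem_cuts_zero_iff (h : IsConsistentScheme ξ k ω cuts vert) (t : ℤ) :
    (t ∈ cuts 0 ↔ ∃ v, ω t = minPath ξ v) ∧ (t ∈ cuts 0 → vert 0 t = endpoint (ω t)) := by
  obtain ⟨s, hs, hst, hmax⟩ := exists_greatest_le (h.1 0) t
  obtain ⟨u, hu, hsu, hno⟩ := exists_next (h.2.1 0) s
  obtain ⟨hsum, hword⟩ := h.2.2.1 0 s hs u hu hsu hno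
  set v := vert 0 s with hv
  have htu : t < u := by
    by_contra htu
    have := hmax u hu (by omega)
    omega
  have hblock : codedBlock ξ k v = segList ξ v := by
    rw [codedBlock_eq_map_take _ _ _ (by omega)]
    conv_rhs => rw [← List.map_id (segList ξ v)]
    rw [List.map_inj_left]
    intro w hw
    apply List.take_of_length_le
    rw [length_eq_endpoint, endpoint_of_mem_segList hw, hsum, add_zero]
  obtain ⟨r, rfl⟩ : ∃ r : ℕ, t = s + r := ⟨(t - s).toNat, by omega⟩
  have hlt : r < (u - s).toNat := by omega
  have hget : (segList ξ v)[r]? = some (ω (s + r)) := by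
    rw [← hblock, ← hword, wordAt_eq, List.getElem?_map, List.getElem?_range hlt]
    rfl
  have hend : endpoint (ω (s + r)) = v := endpoint_of_mem_segList (List.mem_of_getElem? hget)
  have hhead : (segList ξ v)[0]? = some (minPath ξ v) := by
    rw [← List.head?_eq_getElem?, head?_segList]
  have hzero : s + (r : ℤ) ∈ cuts 0 → r = 0 := fun hm => by
    have := hmax _ hm le_rfl
    omega
  refine ⟨⟨fun hm => ?_, ?_⟩, fun hm => ?_⟩
  · obtain rfl := hzero hm
    exact ⟨v, Option.some_inj.1 (hget.symm.trans hhead)⟩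
  · rintro ⟨v', hv'⟩
    obtain rfl : v' = v := by rw [← hend, hv', endpoint_minPath]
    rw [hv', ← hhead] at hget
    have := (List.getElem?_inj (length_segList_pos ξ _) (nodup_segList ξ _)).1 hget.symm
    simpa [← this] using hs
  · obtain rfl := hzero hm
    rw [hend, hv]
    simp

lemma unique (hk : 3 ≤ k) {cuts' : ℕ → Set ℤ} {vert' : ℕ → ℤ → ℕ × ℕ}
    (h : IsConsistentScheme ξ k ω cuts vert) (h' : IsConsistentScheme ξ k ω cuts' vert') (j : ℕ) :
    cuts j = cuts' j ∧ ∀ s ∈ cuts j, vert j s = vert' j s := by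
  induction j with
  | zero =>
    have hc : cuts 0 = cuts' 0 := by
      ext t
      rw [(h.mem_cuts_zero_iff t).1, (h'.mem_cuts_zero_iff t).1]
    refine ⟨hc, fun s hs => ?_⟩
    rw [(h.mem_cuts_zero_iff s).2 hs, (h'.mem_cuts_zero_iff s).2 (hc ▸ hs)]
  | succ j ih =>
    obtain ⟨hc, hvert⟩ := ih
    obtain ⟨e, he, hr⟩ := exists_strictMono_range_eq (h.1 j) (h.2.1 j)
    have hA := h.isGrouping (by omega) he hr
    have hB := h'.isGrouping (by omega) he (hr.trans hc)
    have hm : (fun i => ((vert' j (e i)).2 : ℤ)) = fun i => ((vert j (e i)).2 : ℤ) := by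
      funext i
      rw [hvert (e i) (hr ▸ Set.mem_range_self i)]
    rw [hm] at hB
    have hN : (3 : ℤ) ≤ (k + j : ℕ) := by omega
    have h0 : ∀ i, (0 : ℤ) ≤ (vert j (e i)).2 := fun i => by omega
    have hle : ∀ i, ((vert j (e i)).2 : ℤ) ≤ (k + j : ℕ) := fun i => by
      have := h.vert_sum (j := j) (s := e i) (hr ▸ Set.mem_range_self i)
      omega
    have hAB := IsGrouping.imp_of_isGrouping hN (fun _ _ => LabelRel.adjacent)
      (fun _ _ => LabelRel.asymm) h0 hle hA hB
    have hBA := IsGrouping.imp_of_isGrouping hN (fun _ _ => LabelRel.adjacent)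
      (fun _ _ => LabelRel.asymm) h0 hle hB hA
    have hcuts : cuts (j + 1) = cuts' (j + 1) := by
      ext s
      constructor
      · intro hs
        obtain ⟨i, rfl⟩ : s ∈ Set.range e := hr ▸ h.2.2.2.1 j hs
        exact hAB i hs
      · intro hs
        obtain ⟨i, rfl⟩ : s ∈ Set.range e := (hr.trans hc) ▸ h'.2.2.2.1 j hs
        exact hBA i hs
    refine ⟨hcuts, fun s hs => ?_⟩
    obtain ⟨i, rfl⟩ : s ∈ Set.range e := hr ▸ h.2.2.2.1 j hs
    rw [← hcuts] at hB
    have hl := IsGrouping.label_eq (by omega) hA hB hs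
    have s1 := h.vert_sum hs
    have s2 := h'.vert_sum (hcuts ▸ hs)
    ext <;> omega

end IsConsistentScheme

theorem stmt6 (ξ : ℕ × ℕ → Bool) (γ : ℕ → Bool) (hγ : γ ∉ XPrime ξ) :
    IsConsistentScheme ξ 3 (omegaCode ξ 3 γ) (natCuts ξ 3 γ) (natVert ξ 3 γ) ∧
    ∀ (cuts : ℕ → Set ℤ) (vert : ℕ → ℤ → ℕ × ℕ),
      IsConsistentScheme ξ 3 (omegaCode ξ 3 γ) cuts vert →
        cuts = natCuts ξ 3 γ ∧ ∀ j : ℕ, ∀ s ∈ cuts j, vert j s = natVert ξ 3 γ j s := by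
  have hnat := natScheme_isConsistent hγ 3
  refine ⟨hnat, fun cuts vert h => ⟨?_, fun j => (h.unique le_rfl hnat j).2⟩⟩
  funext j
  exact (h.unique le_rfl hnat j).1
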